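/- Let F_q be a finite field of characteristic different from 2 and let a, b ∈ F_q be such that Δ := a² − 4b is a non-square in F_q and Δ = −b (so a² = 3b and a, b ≠ 0). In R = F_q[x₁₁, x₁₂, x₂₁, x₂₂], let J be the ideal generated by the four polynomials f₁ = a·x₁₂x₂₁ − b·x₁₁x₂₁ + b·x₂₂ + x₁₁x₁₂, f₂ = a·x₂₁x₂₂ − a·x₂₂ − b·x₂₁² + x₁₁x₂₂ − x₁₂, f₃ = ab·x₂₂ + a·x₁₂x₂₂ − b²·x₂₁ − b·x₁₁x₂₂ + x₁₂², f₄ = a²·x₂₂ − ab·x₂₁ + a·x₁₂ − a·x₂₂² − b·x₁₁ + b·x₂₁x₂₂ − x₁₂x₂₂, and let 𝔭₁ = ⟨x₁₁ + x₂₂ − a, x₁₂ − b·x₂₁ + a·x₂₂ − b, x₂₁² − (a/b)x₂₁x₂₂ + x₂₁ + (1/b)x₂₂² − (a/b)x₂₂ + 1⟩, 𝔭₂ = ⟨x₁₁ + 2x₂₂ − a, x₁₂ + a·x₂₂ − b, x₂₁ − (a/b)x₂₂ + 1, x₂₂² − a·x₂₂ + b⟩, 𝔭₃ = ⟨x₁₁,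 x₁₂, x₂₁, x₂₂⟩. Then the radical of J equals 𝔭₁ ∩ 𝔭₂ ∩ 𝔭₃. -/

import Mathlib

theorem alg_case {D : Type*} [CommRing D] [IsDomain D] (a b c x0 x1 x2 x3 : D) (hb : b ≠ 0) (h2 : (2:D) ≠ 0)
  (hab : a^2 = 3*b) (hc : b*c=1)
  (f1 : a*x1*x2 - b*x0*x2+b*x3+x0*x1=0) (f2 : a*x2*x3-a*x3-b*x2^2+x0*x3-x1=0)
  (f3 : a*b*x3+a*x1*x3-b^2*x2-b*x0*x3+x1^2=0)
  (f4 : a^2*x3-a*b*x2+a*x1-a*x3^2-b*x0+b*x2*x3-x1*x3=0) :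
  (x0+x3-a=0 ∧ x1 - b*x2+a*x3-b=0 ∧ x2^2 - a*c*x2*x3+x2+c*x3^2-a*c*x3+1=0) ∨
  (x0+2*x3-a=0 ∧ x1 +a*x3-b=0 ∧ x2 - a*c*x3+1=0 ∧ x3^2-a*x3+b=0) ∨ 
  (x0=0 ∧ x1=0 ∧ x2=0∧ x3=0) := by
  by_cases u : x1 - b*x2+a*x3-b=0
  · have t : x0+x3-a=0 := by grind
    exact Or.inl ⟨t, u, by grind⟩
  right
  have h1 : x1 + b*x2 = 0 := by
    apply (mul_eq_zero.1 (_ : (x1 - b*x2+a*x3-b) * (x1 + b*x2) = 0)).resolve_left u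
    linear_combination f3 + b*f2
  have e1 : x1 = -b*x2 := by linear_combination h1
  subst e1
  have h0 : x0 - x3 + a*x2 = 0 := by
    apply (mul_eq_zero.1 (_ : (-b*x2 - b*x2+a*x3-b) * (x0 - x3+a*x2) = 0)).resolve_left u
    linear_combination f1 + a*f2 + f4 
  have e0 : x0 = x3 - a*x2 := by linear_combination h0
  subst e0
  have k1 : x3^2-b*x2=0 := by
    apply (mul_eq_zero.1 (_ : (-b*x2 - b*x2+a*x3-b) * (x3^2-b*x2) = 0)).resolve_left u
    have : -x3*(a^2*x3-a*b*x2+a*(-b*x2)-a*x3^2-b*(x3-a*x2)+b*x2*x3+b*x2*x3) + b*(a*x2*x3-a*x3-b*x2^2+(x3-a*x2)*x3+b*x2)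
       + a*(a*(-b*x2)*x2 - b*(x3-a*x2)*x2+b*x3+(x3-a*x2)*(-b*x2)) = 0 := by
      linear_combination -x3*f4+b*f2+a*f1
    grind
  have k2 : x2 *(b*x2 - a*x3+b)=0 := by
    have e3 : x3^2 = b*x2 := by linear_combination k1
    have g2 : 2*b*x2-a*x3-b*x2^2 = 0 := by linear_combination f2 - k1
    have g4 : x3 - a*x2+x2*x3 = 0 := by
      apply (mul_eq_zero.1 (_ : (2*b) * (x3 - a*x2+x2*x3) = 0)).resolve_left (mul_ne_zero h2 hb)
      linear_combination f4 + a*k1 - x3*hab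
    linear_combination -g2 - a*g4 - x2*hab
  rcases mul_eq_zero.1 k2 with h | h
  · right
    grind
  · left
    refine ⟨?_, ?_, ?_, ?_⟩ <;> grind

theorem quad_reduced {S : Type*} [CommRing S] [IsDomain S] (A B : S) (h2 : (2:S) ≠ 0)
    (hD : B^2+4*A ≠ 0) : IsReduced (QuadraticAlgebra S A B) := by
  refine (isReduced_iff_pow_one_lt 2 one_lt_two).2 ?_
  rintro ⟨g, h⟩ hz
  rw [pow_two, QuadraticAlgebra.mk_mul_mk] at hz
  have e1 := congrArg QuadraticAlgebra.re hz
  have e2 := congrArg QuadraticAlgebra.im hz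
  simp only [QuadraticAlgebra.re_zero, QuadraticAlgebra.im_zero] at e1 e2
  have hh : h = 0 := by
    by_contra hne
    have e3 : 2*g + B*h = 0 := by
      apply (mul_eq_zero.1 (_ : h * (2*g+B*h) = 0)).resolve_left hne
      linear_combination e2
    apply hD
    apply (mul_eq_zero.1 (_ : (h^2) * (B^2+4*A) = 0)).resolve_left (pow_ne_zero 2 hne)
    linear_combination 4*e1 + (B*h-2*g)*e3
  subst hh
  have hg : g = 0 := by
    have : g^2 = 0 := by linear_combination e1
    exact pow_eq_zero_iff (two_ne_zero) |>.1 this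
  subst hg
  rfl

theorem rad_of {F : Type*} [Field F] (I : Ideal (MvPolynomial (Fin 4) F))
    {S : Type*} [CommRing S] [IsDomain S] (A B : S) (h2 : (2:S) ≠ 0)
    (hD : B^2+4*A ≠ 0) (φ : MvPolynomial (Fin 4) F →+* QuadraticAlgebra S A B)
    (σ : S →+* MvPolynomial (Fin 4) F) (w : MvPolynomial (Fin 4) F)
    (hσ : ∀ s, φ (σ s) = ⟨s, 0⟩) (hw : φ w = ⟨0, 1⟩)
    (hI : ∀ f ∈ I, φ f = 0)
    (hC : ∀ r : F, ∃ s, MvPolynomial.C r - σ s ∈ I)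
    (hX : ∀ i, ∃ g h, MvPolynomial.X i - (σ g + w * σ h) ∈ I)
    (hq : w^2 - (σ A + σ B * w) ∈ I) : I.IsRadical := by
  have := quad_reduced A B h2 hD
  have key : ∀ f, ∃ g h, f - (σ g + w * σ h) ∈ I := by
    intro f
    induction f using MvPolynomial.induction_on with
    | C r =>
      obtain ⟨s, hs⟩ := hC r
      exact ⟨s, 0, by simpa using hs⟩
    | add p q hp hq' =>
      obtain ⟨g, h, e⟩ := hp
      obtain ⟨g', h', e'⟩ := hq'
      refine ⟨g+g', h+h', ?_⟩
      convert I.add_mem e e' using 1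
      simp only [map_add]; ring
    | mul_X p i hp =>
      obtain ⟨g, h, e⟩ := hp
      obtain ⟨g', h', e'⟩ := hX i
      refine ⟨g*g'+h*h'*A, g*h'+h*g'+h*h'*B, ?_⟩
      convert I.add_mem (I.add_mem (I.mul_mem_left (MvPolynomial.X i) e)
        (I.mul_mem_left (σ g + w * σ h) e')) (I.mul_mem_left (σ h * σ h') hq) using 1
      simp only [map_add, map_mul]; ring
  rintro f ⟨n, hn⟩
  have h0 : φ f = 0 := by
    have := hI _ hn
    rw [map_pow] at this
    exact eq_zero_of_pow_eq_zero this
  obtain ⟨g, h, e⟩ := key f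
  have h1 := hI _ e
  rw [map_sub, h0, map_add, map_mul, hσ, hσ, hw, QuadraticAlgebra.mk_mul_mk,
    zero_sub, neg_eq_zero] at h1
  have e1 := congrArg QuadraticAlgebra.re h1
  have e2 := congrArg QuadraticAlgebra.im h1
  simp at e1 e2
  subst e2
  subst e1
  simpa using e

open MvPolynomial in
theorem rad1 {F : Type*} [Field F] (h2 : (2:F) ≠ 0) (a b : F) (hb : b ≠ 0) (hab : a^2 = 3*b) :
    (Ideal.span {X 0 + X 3 - C a, X 1 - C b * X 2 + C a * X 3 - C b,
        X 2 ^ 2 - C (a / b) * X 2 * X 3 + X 2 + C (1 / b) * X 3 ^ 2 - C (a / b) * X 3 + 1} :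
      Ideal (MvPolynomial (Fin 4) F)).IsRadical := by
  set I := (Ideal.span {X 0 + X 3 - C a, X 1 - C b * X 2 + C a * X 3 - C b,
        X 2 ^ 2 - C (a / b) * X 2 * X 3 + X 2 + C (1 / b) * X 3 ^ 2 - C (a / b) * X 3 + 1} :
      Ideal (MvPolynomial (Fin 4) F)) with hIdef
  have m1 : X 0 + X 3 - C a ∈ I := Ideal.subset_span (by simp)
  have m2 : X 1 - C b * X 2 + C a * X 3 - C b ∈ I := Ideal.subset_span (by simp)
  have m3 : X 2 ^ 2 - C (a / b) * X 2 * X 3 + X 2 + C (1 / b) * X 3 ^ 2 - C (a / b) * X 3 + 1 ∈ I :=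
    Ideal.subset_span (by simp)
  let A : Polynomial F := -Polynomial.C (1/b) * Polynomial.X^2 + Polynomial.C (a/b) * Polynomial.X - 1
  let B : Polynomial F := Polynomial.C (a/b) * Polynomial.X - 1
  let q : QuadraticAlgebra (Polynomial F) A B := ⟨0, 1⟩
  let ι : Polynomial F →+* QuadraticAlgebra (Polynomial F) A B := algebraMap _ _
  let φ : MvPolynomial (Fin 4) F →+* QuadraticAlgebra (Polynomial F) A B :=
    eval₂Hom (ι.comp Polynomial.C) ![ι (Polynomial.C a - Polynomial.X),
      ι (Polynomial.C b) * q - ι (Polynomial.C a * Polynomial.X) + ι (Polynomial.C b), q, ι Polynomial.X]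
  have hqq : q^2 = ι A + ι B * q := by
    simp only [q, ι, QuadraticAlgebra.algebraMap_eq, pow_two, QuadraticAlgebra.mk_mul_mk,
      QuadraticAlgebra.mk_add_mk]
    congr 1 <;> simp
  have hφC : ∀ r, φ (C r) = ι (Polynomial.C r) := by intro r; simp [φ]
  have hφ0 : φ (X 0) = ι (Polynomial.C a - Polynomial.X) := by simp [φ]
  have hφ1 : φ (X 1) = ι (Polynomial.C b) * q - ι (Polynomial.C a * Polynomial.X) + ι (Polynomial.C b) := by simp [φ]
  have hφ2 : φ (X 2) = q := by simp [φ]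
  have hφ3 : φ (X 3) = ι Polynomial.X := by simp [φ]
  have h2' : (2 : Polynomial F) ≠ 0 := by
    intro h
    apply h2
    have := congrArg (Polynomial.eval 0) h
    simpa using this
  have hD : B^2 + 4*A ≠ 0 := by
    intro h
    have := congrArg (Polynomial.eval (a+1)) h
    simp [A, B] at this
    field_simp at this
    have h3 : b = 0 := by grind
    exact hb h3
  refine rad_of I A B h2' hD φ (Polynomial.eval₂RingHom C (X 3)) (X 2) ?_ hφ2 ?_ ?_ ?_ ?_
  · intro s
    have : φ.comp (Polynomial.eval₂RingHom C (X 3)) = ι := by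
      apply Polynomial.ringHom_ext
      · intro r; simp [hφC]
      · simp [hφ3]
    exact congrArg (fun f => f s) this
  · intro f hf
    have hle : I ≤ RingHom.ker φ := by
      rw [hIdef, Ideal.span_le]
      rintro f (rfl | rfl | rfl)
      · simp only [SetLike.mem_coe, RingHom.mem_ker, map_add, map_sub, map_mul, map_pow, map_one, hφC, hφ0, hφ3]
        ring
      · simp only [SetLike.mem_coe, RingHom.mem_ker, map_add, map_sub, map_mul, map_pow, map_one, hφC, hφ1, hφ2, hφ3]
        ring
      · simp only [SetLike.mem_coe, RingHom.mem_ker, map_add, map_sub, map_mul, map_pow, map_one, hφC, hφ1, hφ2, hφ3]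
        rw [hqq]
        simp only [A, B, map_add, map_sub, map_mul, map_pow, map_one, map_neg]
        ring
    exact hle hf
  · intro r
    exact ⟨Polynomial.C r, by simp⟩
  · intro i
    fin_cases i
    · refine ⟨Polynomial.C a - Polynomial.X, 0, ?_⟩
      convert m1 using 1
      simp; ring
    · refine ⟨Polynomial.C b - Polynomial.C a * Polynomial.X, Polynomial.C b, ?_⟩
      convert m2 using 1
      simp; ring
    · refine ⟨0, 1, ?_⟩
      simp
    · refine ⟨Polynomial.X, 0, ?_⟩
      simp
  · convert m3 using 1
    simp [A, B, -map_div₀]; ring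

open MvPolynomial in
theorem rad2 {F : Type*} [Field F] (h2 : (2:F) ≠ 0) (a b : F) (hb : b ≠ 0) (hab : a^2 = 3*b) :
    (Ideal.span {X 0 + 2 * X 3 - C a, X 1 + C a * X 3 - C b, X 2 - C (a / b) * X 3 + 1,
        X 3 ^ 2 - C a * X 3 + C b} :
      Ideal (MvPolynomial (Fin 4) F)).IsRadical := by
  set I := (Ideal.span {X 0 + 2 * X 3 - C a, X 1 + C a * X 3 - C b, X 2 - C (a / b) * X 3 + 1,
        X 3 ^ 2 - C a * X 3 + C b} :
      Ideal (MvPolynomial (Fin 4) F)) with hIdef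
  have m1 : X 0 + 2 * X 3 - C a ∈ I := Ideal.subset_span (by simp)
  have m2 : X 1 + C a * X 3 - C b ∈ I := Ideal.subset_span (by simp)
  have m3 : X 2 - C (a / b) * X 3 + 1 ∈ I := Ideal.subset_span (by simp)
  have m4 : X 3 ^ 2 - C a * X 3 + C b ∈ I := Ideal.subset_span (by simp)
  let q : QuadraticAlgebra F (-b) a := ⟨0, 1⟩
  let ι : F →+* QuadraticAlgebra F (-b) a := algebraMap _ _
  let φ : MvPolynomial (Fin 4) F →+* QuadraticAlgebra F (-b) a :=
    eval₂Hom ι ![ι a - 2 * q, ι b - ι a * q, ι (a/b) * q - 1, q]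
  have hqq : q^2 = ι (-b) + ι a * q := by
    simp only [q, ι, QuadraticAlgebra.algebraMap_eq, pow_two, QuadraticAlgebra.mk_mul_mk,
      QuadraticAlgebra.mk_add_mk]
    congr 1 <;> simp
  have hφC : ∀ r, φ (C r) = ι r := by intro r; simp [φ]
  have hφ0 : φ (X 0) = ι a - 2 * q := by simp [φ]
  have hφ1 : φ (X 1) = ι b - ι a * q := by simp [φ]
  have hφ2 : φ (X 2) = ι (a/b) * q - 1 := by simp [φ]
  have hφ3 : φ (X 3) = q := by simp [φ]
  have hD : a^2 + 4*(-b) ≠ 0 := by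
    intro h
    exact hb (by linear_combination hab - h)
  refine rad_of I (-b) a h2 hD φ C (X 3) ?_ hφ3 ?_ ?_ ?_ ?_
  · exact hφC
  · intro f hf
    have hle : I ≤ RingHom.ker φ := by
      rw [hIdef, Ideal.span_le]
      rintro f (rfl | rfl | rfl | rfl)
      · simp only [SetLike.mem_coe, RingHom.mem_ker, map_add, map_sub, map_mul, map_ofNat, hφC, hφ0, hφ3]
        ring
      · simp only [SetLike.mem_coe, RingHom.mem_ker, map_add, map_sub, map_mul, map_pow, map_one, hφC, hφ1, hφ2, hφ3]
        ring
      · simp only [SetLike.mem_coe, RingHom.mem_ker, map_add, map_sub, map_mul, map_pow, map_one, hφC, hφ1, hφ2, hφ3]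
        ring
      · simp only [SetLike.mem_coe, RingHom.mem_ker, map_add, map_sub, map_mul, map_pow, map_one, hφC, hφ1, hφ2, hφ3]
        rw [hqq, map_neg]
        ring
    exact hle hf
  · intro r
    exact ⟨r, by simp⟩
  · intro i
    fin_cases i
    · refine ⟨a, -2, ?_⟩
      convert m1 using 1
      simp only [map_neg, map_ofNat, Fin.zero_eta]; ring
    · refine ⟨b, -a, ?_⟩
      convert m2 using 1
      simp; ring
    · refine ⟨-1, a/b, ?_⟩
      convert m3 using 1
      simp [-map_div₀]; ring
    · refine ⟨0, 1, ?_⟩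
      simp
  · convert m4 using 1
    simp; ring

open MvPolynomial in
theorem rad3 {F : Type*} [Field F] :
    (Ideal.span {X 0, X 1, X 2, X 3} : Ideal (MvPolynomial (Fin 4) F)).IsRadical := by
  set I := (Ideal.span {X 0, X 1, X 2, X 3} : Ideal (MvPolynomial (Fin 4) F)) with hIdef
  have hle : I ≤ RingHom.ker (constantCoeff (R := F) (σ := Fin 4)) := by
    rw [hIdef, Ideal.span_le]
    rintro f (rfl | rfl | rfl | rfl) <;> simp
  have hX : ∀ i, (X i : MvPolynomial (Fin 4) F) ∈ I := by
    intro i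
    apply Ideal.subset_span
    fin_cases i <;> simp
  have key : ∀ f : MvPolynomial (Fin 4) F, f - C (constantCoeff f) ∈ I := by
    intro f
    induction f using MvPolynomial.induction_on with
    | C r => simp
    | add p q hp hq =>
      convert I.add_mem hp hq using 1
      simp only [map_add]; ring
    | mul_X p i hp =>
      convert I.mul_mem_left p (hX i) using 1
      simp
  rintro f ⟨n, hn⟩
  have h0 : constantCoeff f = 0 := by
    have : constantCoeff (f^n) = 0 := hle hn
    rw [map_pow] at this
    exact eq_zero_of_pow_eq_zero this
  simpa [h0] using key f

theorem alg1 {D : Type*} [CommRing D] (a b c x0 x1 x2 x3 : D)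
    (hab : a^2 = 3*b) (hc : b*c=1) (h1 : x0+x3-a=0) (h2 : x1 - b*x2+a*x3-b=0)
    (h3 : x2^2 - a*c*x2*x3+x2+c*x3^2-a*c*x3+1=0) :
    a*x1*x2 - b*x0*x2+b*x3+x0*x1=0 ∧ a*x2*x3-a*x3-b*x2^2+x0*x3-x1=0 ∧
    a*b*x3+a*x1*x3-b^2*x2-b*x0*x3+x1^2=0 ∧
    a^2*x3-a*b*x2+a*x1-a*x3^2-b*x0+b*x2*x3-x1*x3=0 := by
  have e0 : x0 = a - x3 := by linear_combination h1
  have e1 : x1 = b*x2-a*x3+b := by linear_combination h2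
  have e3 : b*x2^2 - a*x2*x3+b*x2+x3^2-a*x3+b=0 := by
    linear_combination b*h3 + (a*x2*x3-x3^2+a*x3)*hc
  subst e0 e1
  refine ⟨?_, ?_, ?_, ?_⟩ <;> grind

theorem alg2 {D : Type*} [CommRing D] (a b c x0 x1 x2 x3 : D)
    (hab : a^2 = 3*b) (hc : b*c=1) (h1 : x0+2*x3-a=0) (h2 : x1 +a*x3-b=0)
    (h3 : x2 - a*c*x3+1=0) (h4 : x3^2-a*x3+b=0) :
    a*x1*x2 - b*x0*x2+b*x3+x0*x1=0 ∧ a*x2*x3-a*x3-b*x2^2+x0*x3-x1=0 ∧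
    a*b*x3+a*x1*x3-b^2*x2-b*x0*x3+x1^2=0 ∧
    a^2*x3-a*b*x2+a*x1-a*x3^2-b*x0+b*x2*x3-x1*x3=0 := by
  refine ⟨?_, ?_, ?_, ?_⟩ <;> grind

/-- Over a finite field of odd characteristic, with `Δ = a² − 4b` a non-square and
`Δ = −b`, the radical of the ideal `J = ⟨f₁, f₂, f₃, f₄⟩` of
`R = F_q[x₁₁, x₁₂, x₂₁, x₂₂]` (variables `X 0, X 1, X 2, X 3`) equals `𝔭₁ ∩ 𝔭₂ ∩ 𝔭₃`. -/
theorem stmt_15 {F : Type*} [Field F] [Fintype F] (hchar : ringChar F ≠ 2) (a b : F)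
    (hns : ¬∃ c : F, c ^ 2 = a ^ 2 - 4 * b) (hΔ : a ^ 2 - 4 * b = -b) :
    let x : Fin 4 → MvPolynomial (Fin 4) F := MvPolynomial.X
    let C : F → MvPolynomial (Fin 4) F := MvPolynomial.C
    let J : Ideal (MvPolynomial (Fin 4) F) := Ideal.span
      {C a * x 1 * x 2 - C b * x 0 * x 2 + C b * x 3 + x 0 * x 1,
        C a * x 2 * x 3 - C a * x 3 - C b * x 2 ^ 2 + x 0 * x 3 - x 1,
        C (a * b) * x 3 + C a * x 1 * x 3 - C (b ^ 2) * x 2 - C b * x 0 * x 3 + x 1 ^ 2,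
        C (a ^ 2) * x 3 - C (a * b) * x 2 + C a * x 1 - C a * x 3 ^ 2 - C b * x 0 +
          C b * x 2 * x 3 - x 1 * x 3}
    let p₁ : Ideal (MvPolynomial (Fin 4) F) := Ideal.span
      {x 0 + x 3 - C a, x 1 - C b * x 2 + C a * x 3 - C b,
        x 2 ^ 2 - C (a / b) * x 2 * x 3 + x 2 + C (1 / b) * x 3 ^ 2 - C (a / b) * x 3 + 1}
    let p₂ : Ideal (MvPolynomial (Fin 4) F) := Ideal.span
      {x 0 + 2 * x 3 - C a, x 1 + C a * x 3 - C b, x 2 - C (a / b) * x 3 + 1,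
        x 3 ^ 2 - C a * x 3 + C b}
    let p₃ : Ideal (MvPolynomial (Fin 4) F) := Ideal.span {x 0, x 1, x 2, x 3}
    J.radical = p₁ ⊓ p₂ ⊓ p₃ := by
  intro x C J p₁ p₂ p₃
  have h2 : (2 : F) ≠ 0 := Ring.two_ne_zero hchar
  have hab : a ^ 2 = 3 * b := by linear_combination hΔ
  have hb : b ≠ 0 := by
    rintro rfl
    exact hns ⟨0, by rw [hΔ]; simp⟩
  have habC : C a ^ 2 = 3 * C b := by
    have := congrArg C hab
    simpa only [C, map_pow, map_mul, map_ofNat] using this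
  have hcC : C b * C (1 / b) = 1 := by
    simp only [C, ← MvPolynomial.C_mul]
    rw [mul_one_div_cancel hb, MvPolynomial.C_1]
  have hdiv : C (a / b) = C a * C (1 / b) := by
    simp only [C, ← MvPolynomial.C_mul]
    rw [mul_one_div]
  have hCm : ∀ r s, C (r * s) = C r * C s := fun r s => MvPolynomial.C_mul
  have hCp : ∀ r, C (r ^ 2) = C r ^ 2 := fun r => by simp [C]
  have hr1 : p₁.IsRadical := rad1 h2 a b hb hab
  have hr2 : p₂.IsRadical := rad2 h2 a b hb hab
  have hr3 : p₃.IsRadical := rad3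
  have hJ : ∀ P : Ideal (MvPolynomial (Fin 4) F), J ≤ P ↔
      (let π := Ideal.Quotient.mk P
       let A := π (C a)
       let B := π (C b)
       let y0 := π (x 0)
       let y1 := π (x 1)
       let y2 := π (x 2)
       let y3 := π (x 3)
       A*y1*y2 - B*y0*y2+B*y3+y0*y1=0 ∧ A*y2*y3-A*y3-B*y2^2+y0*y3-y1=0 ∧
        A*B*y3+A*y1*y3-B^2*y2-B*y0*y3+y1^2=0 ∧
        A^2*y3-A*B*y2+A*y1-A*y3^2-B*y0+B*y2*y3-y1*y3=0) := by
    intro P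
    simp only [J, Ideal.span_le, Set.insert_subset_iff, Set.singleton_subset_iff, SetLike.mem_coe,
      ← Ideal.Quotient.eq_zero_iff_mem, hCm, hCp, map_add, map_sub, map_mul, map_pow]
  have hp1 : ∀ P : Ideal (MvPolynomial (Fin 4) F), p₁ ≤ P ↔
      (let π := Ideal.Quotient.mk P
       let A := π (C a)
       let B := π (C b)
       let c := π (C (1 / b))
       let y0 := π (x 0)
       let y1 := π (x 1)
       let y2 := π (x 2)
       let y3 := π (x 3)
       y0+y3-A=0 ∧ y1 - B*y2+A*y3-B=0 ∧ y2^2 - A*c*y2*y3+y2+c*y3^2-A*c*y3+1=0) := by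
    intro P
    simp only [p₁, Ideal.span_le, Set.insert_subset_iff, Set.singleton_subset_iff, SetLike.mem_coe,
      ← Ideal.Quotient.eq_zero_iff_mem, hdiv, map_add, map_sub, map_mul, map_pow, map_one]
  have hp2 : ∀ P : Ideal (MvPolynomial (Fin 4) F), p₂ ≤ P ↔
      (let π := Ideal.Quotient.mk P
       let A := π (C a)
       let B := π (C b)
       let c := π (C (1 / b))
       let y0 := π (x 0)
       let y1 := π (x 1)
       let y2 := π (x 2)
       let y3 := π (x 3)
       y0+2*y3-A=0 ∧ y1+A*y3-B=0 ∧ y2 - A*c*y3+1=0 ∧ y3^2-A*y3+B=0) := by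
    intro P
    simp only [p₂, Ideal.span_le, Set.insert_subset_iff, Set.singleton_subset_iff, SetLike.mem_coe,
      ← Ideal.Quotient.eq_zero_iff_mem, hdiv, map_add, map_sub, map_mul, map_pow, map_one,
      map_ofNat]
  have hp3 : ∀ P : Ideal (MvPolynomial (Fin 4) F), p₃ ≤ P ↔
      (let π := Ideal.Quotient.mk P
       π (x 0) = 0 ∧ π (x 1) = 0 ∧ π (x 2) = 0 ∧ π (x 3) = 0) := by
    intro P
    simp only [p₃, Ideal.span_le, Set.insert_subset_iff, Set.singleton_subset_iff, SetLike.mem_coe,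
      ← Ideal.Quotient.eq_zero_iff_mem]
  have hab' : ∀ P : Ideal (MvPolynomial (Fin 4) F),
      (Ideal.Quotient.mk P (C a)) ^ 2 = 3 * Ideal.Quotient.mk P (C b) := by
    intro P
    rw [← map_pow, habC, map_mul, map_ofNat]
  have hc' : ∀ P : Ideal (MvPolynomial (Fin 4) F),
      Ideal.Quotient.mk P (C b) * Ideal.Quotient.mk P (C (1 / b)) = 1 := by
    intro P
    rw [← map_mul, hcC, map_one]
  apply le_antisymm
  · refine le_inf (le_inf ?_ ?_) ?_
    · rw [hr1.radical_le_iff, hJ]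
      obtain ⟨k1, k2, k3⟩ := (hp1 p₁).1 le_rfl
      exact alg1 _ _ _ _ _ _ _ (hab' _) (hc' _) k1 k2 k3
    · rw [hr2.radical_le_iff, hJ]
      obtain ⟨k1, k2, k3, k4⟩ := (hp2 p₂).1 le_rfl
      exact alg2 _ _ _ _ _ _ _ (hab' _) (hc' _) k1 k2 k3 k4
    · rw [hr3.radical_le_iff, hJ]
      obtain ⟨k1, k2, k3, k4⟩ := (hp3 p₃).1 le_rfl
      simp only [k1, k2, k3, k4]
      simp
  · rw [Ideal.radical_eq_sInf]
    refine le_sInf ?_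
    rintro P ⟨hJP, hP⟩
    obtain ⟨k1, k2, k3, k4⟩ := (hJ P).1 hJP
    have hB : Ideal.Quotient.mk P (C b) ≠ 0 := left_ne_zero_of_mul_eq_one (hc' P)
    have h2P : (2 : MvPolynomial (Fin 4) F ⧸ P) ≠ 0 := by
      have e : (2 : MvPolynomial (Fin 4) F ⧸ P) * Ideal.Quotient.mk P (C (1 / 2)) = 1 := by
        have : (2 : MvPolynomial (Fin 4) F) * C (1 / 2) = 1 := by
          have h := congrArg C (mul_one_div_cancel h2)
          rw [hCm] at h
          simpa only [C, map_ofNat, map_one] using h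
        rw [← map_ofNat (Ideal.Quotient.mk P), ← map_mul, this, map_one]
      exact left_ne_zero_of_mul_eq_one e
    rcases alg_case _ _ _ _ _ _ _ hB h2P (hab' P) (hc' P) k1 k2 k3 k4 with h | h | h
    · exact (inf_le_left.trans inf_le_left).trans ((hp1 P).2 h)
    · exact (inf_le_left.trans inf_le_right).trans ((hp2 P).2 h)
    · exact inf_le_right.trans ((hp3 P).2 h)
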